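/- arXiv:2209.13501 — 2 statements merged into one kernel-verified Lean document; each statement's English description precedes it below -/
import Mathlib

section
/- Let r = X → Y be a totally-ordered sequential rule over a sequence database D, and let r' be a ToSR obtained from r by a left I-expansion or a left S-expansion with an item i. Then u(r') ≤ LERSU(r'), where LERSU(r') = Σ_{s ∈ seq(r')} LEPEU(r, s). -/
open scoped Classical

noncomputable section

namespace TotalSR

variable {I : Type*} [LinearOrder I]

/-- A sequence: a list of itemsets. -/
abbrev Seqc (I : Type*) := List (Finset I)

/-- The set of items occurring in a sequence. -/
def itemsOf (s : Seqc I) : Finset I := s.foldr (· ∪ ·) ∅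

/-- Well-formed sequence: nonempty, all itemsets nonempty, and each item
occurs at most once (itemsets pairwise disjoint). -/
def WFSeq (s : Seqc I) : Prop :=
  s ≠ [] ∧ (∀ e ∈ s, e.Nonempty) ∧ s.Pairwise fun a b => Disjoint a b

/-- `s₁` occurs in `s₂` (written s₁ ⊑ s₂): there exist strictly increasing
indices matching each itemset of `s₁` into a superset itemset of `s₂`. -/
def OccursIn (s₁ s₂ : Seqc I) : Prop :=
  ∃ t : List (Finset I), t.Sublist s₂ ∧ List.Forall₂ (· ⊆ ·) s₁ t

/-- The rule X → Y occurs in s: there is a split position 1 ≤ k < |s|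
with X occurring in the first k itemsets and Y in the remaining ones. -/
def RuleOccursIn (X Y s : Seqc I) : Prop :=
  ∃ k, 1 ≤ k ∧ k < s.length ∧ OccursIn X (s.take k) ∧ OccursIn Y (s.drop k)

/-- seq(r): the sequences of the database D in which the rule X → Y occurs. -/
def seqL (D : List (Seqc I)) (X Y : Seqc I) : List (Seqc I) :=
  D.filter fun s => decide (RuleOccursIn X Y s)

/-- ant(r): the sequences of the database D in which the antecedent X occurs. -/
def antL (D : List (Seqc I)) (X : Seqc I) : List (Seqc I) :=
  D.filter fun s => decide (OccursIn X s)

/-- conf(r) = |seq(r)| / |ant(r)|. -/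
def conf (D : List (Seqc I)) (X Y : Seqc I) : ℝ :=
  ((seqL D X Y).length : ℝ) / ((antL D X).length : ℝ)

variable (q : I → Seqc I → ℝ) (iu : I → ℝ)

/-- u(i, s) = q(i, s) · iu(i). -/
def itemUtil (j : I) (s : Seqc I) : ℝ := q j s * iu j

/-- u(r, s): the sum of u(i, s) over all items occurring in X or Y. -/
def ruleUtilIn (X Y s : Seqc I) : ℝ :=
  ∑ j ∈ itemsOf X ∪ itemsOf Y, itemUtil q iu j s

/-- u(r) = Σ_{s ∈ seq(r)} u(r, s). -/
def ruleUtil (D : List (Seqc I)) (X Y : Seqc I) : ℝ :=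
  ((seqL D X Y).map (ruleUtilIn q iu X Y)).sum

/-- I-extension of a sequence: insert item i into the last itemset. -/
def iExt (X : Seqc I) (i : I) : Seqc I := X.dropLast ++ [insert i (X.getLastD ∅)]

/-- S-extension of a sequence: append the singleton itemset {i}. -/
def sExt (X : Seqc I) (i : I) : Seqc I := X ++ [{i}]

/-- X' is obtained from the rule X → Y by a left I- or S-expansion with item i. -/
def IsLeftExp (X Y : Seqc I) (i : I) (X' : Seqc I) : Prop :=
  i ∉ itemsOf Y ∧
    ((X' = iExt X i ∧ ∀ a ∈ X.getLastD ∅, a < i) ∨ X' = sExt X i)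

/-- Y' is obtained from the rule X → Y by a right I- or S-expansion with item i. -/
def IsRightExp (X Y : Seqc I) (i : I) (Y' : Seqc I) : Prop :=
  i ∉ itemsOf X ∧
    ((Y' = iExt Y i ∧ ∀ a ∈ Y.getLastD ∅, a < i) ∨ Y' = sExt Y i)

/-- ULeft(r, s): sum of u(j, s) over items j of s such that some left
expansion of r with j occurs in s. -/
def ULeft (X Y s : Seqc I) : ℝ :=
  ∑ j ∈ (itemsOf s).filter
      (fun j => ∃ X', IsLeftExp X Y j X' ∧ RuleOccursIn X' Y s),
    itemUtil q iu j s

/-- LEPEU(r, s). -/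
def LEPEUs (X Y s : Seqc I) : ℝ :=
  if 0 < ULeft q iu X Y s then ruleUtilIn q iu X Y s + ULeft q iu X Y s else 0

/-- LEPEU(r) = Σ_{s ∈ seq(r)} LEPEU(r, s). -/
def LEPEU (D : List (Seqc I)) (X Y : Seqc I) : ℝ :=
  ((seqL D X Y).map (LEPEUs q iu X Y)).sum

/-- URight(r, s): sum of u(j, s) over items j of s such that some right
expansion of r with j occurs in s. -/
def URight (X Y s : Seqc I) : ℝ :=
  ∑ j ∈ (itemsOf s).filter
      (fun j => ∃ Y', IsRightExp X Y j Y' ∧ RuleOccursIn X Y' s),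
    itemUtil q iu j s

/-- REPEU(r, s). -/
def REPEUs (X Y s : Seqc I) : ℝ :=
  if 0 < URight q iu X Y s then ruleUtilIn q iu X Y s + URight q iu X Y s else 0

/-- REPEU(r) = Σ_{s ∈ seq(r)} REPEU(r, s). -/
def REPEU (D : List (Seqc I)) (X Y : Seqc I) : ℝ :=
  ((seqL D X Y).map (REPEUs q iu X Y)).sum

/-- j occurs strictly after i in s: in a strictly later itemset, or in the
same itemset and strictly greater in the item order. -/
def AfterIn (s : Seqc I) (i j : I) : Prop :=
  ∃ a b : Fin s.length, i ∈ s.get a ∧ j ∈ s.get b ∧ (a < b ∨ (a = b ∧ i < j))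

/-- UILeft(r, i, s): u(i, s) plus the sum of u(j, s) over items j of s
occurring strictly after i such that some left expansion of r with j occurs in s. -/
def UILeft (X Y : Seqc I) (i : I) (s : Seqc I) : ℝ :=
  itemUtil q iu i s +
    ∑ j ∈ (itemsOf s).filter
        (fun j => AfterIn s i j ∧ ∃ X', IsLeftExp X Y j X' ∧ RuleOccursIn X' Y s),
      itemUtil q iu j s

/-- LERSPEU(r') = Σ_{s ∈ seq(r')} (u(r, s) + UILeft(r, i, s)), where r' = X⋄i → Y. -/
def LERSPEU (D : List (Seqc I)) (X Y : Seqc I) (i : I) (X' : Seqc I) : ℝ :=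
  ((seqL D X' Y).map fun s => ruleUtilIn q iu X Y s + UILeft q iu X Y i s).sum

/-- UIRight(r, i, s): u(i, s) plus the sum of u(j, s) over items j of s
occurring strictly after i in s. -/
def UIRight (i : I) (s : Seqc I) : ℝ :=
  itemUtil q iu i s +
    ∑ j ∈ (itemsOf s).filter (fun j => AfterIn s i j), itemUtil q iu j s

/-- RERSPEU(r') = Σ_{s ∈ seq(r')} (u(r, s) + UIRight(r, i, s)), where r' = X → Y⋄i. -/
def RERSPEU (D : List (Seqc I)) (X Y : Seqc I) (i : I) (Y' : Seqc I) : ℝ :=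
  ((seqL D X Y').map fun s => ruleUtilIn q iu X Y s + UIRight q iu i s).sum

/-- The total utility of all items occurring in a sequence. -/
def totalUtil (s : Seqc I) : ℝ := ∑ j ∈ itemsOf s, itemUtil q iu j s

/-- SEU(i): sum, over the sequences of D in which item i occurs, of the
total utility of the sequence. -/
def SEUitem (D : List (Seqc I)) (i : I) : ℝ :=
  ((D.filter fun s => decide (i ∈ itemsOf s)).map (totalUtil q iu)).sum

/-- SEU(r): sum, over the sequences of D in which the rule r occurs, of the
total utility of the sequence. -/
def SEUrule (D : List (Seqc I)) (X Y : Seqc I) : ℝ :=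
  ((seqL D X Y).map (totalUtil q iu)).sum

/-- One expansion step on rules (as pairs (antecedent, consequent)):
either a left I- or S-expansion or a right I- or S-expansion with some item. -/
def ExpStep (p p' : Seqc I × Seqc I) : Prop :=
  (∃ i, IsLeftExp p.1 p.2 i p'.1 ∧ p'.2 = p.2) ∨
    (∃ i, IsRightExp p.1 p.2 i p'.2 ∧ p'.1 = p.1)

lemma mem_itemsOf {s : Seqc I} {a : I} : a ∈ itemsOf s ↔ ∃ e ∈ s, a ∈ e := by
  induction s with
  | nil => simp [itemsOf]
  | cons e s ih =>
    have h : itemsOf (e :: s) = e ∪ itemsOf s := rfl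
    simp [h, ih]

lemma OccursIn.itemsOf_subset {s₁ s₂ : Seqc I} (h : OccursIn s₁ s₂) :
    itemsOf s₁ ⊆ itemsOf s₂ := by
  obtain ⟨t, ht, hst⟩ := h
  intro a ha
  obtain ⟨e, he, hae⟩ := mem_itemsOf.1 ha
  obtain ⟨n, hn, rfl⟩ := List.mem_iff_getElem.1 he
  have hn' : n < t.length := hst.length_eq ▸ hn
  exact mem_itemsOf.2 ⟨t[n], ht.subset (List.getElem_mem hn'), hst.get hn hn' hae⟩

lemma RuleOccursIn.itemsOf_left_subset {X Y s : Seqc I} (h : RuleOccursIn X Y s) :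
    itemsOf X ⊆ itemsOf s := by
  obtain ⟨k, -, -, hX, -⟩ := h
  intro a ha
  obtain ⟨e, he, hae⟩ := mem_itemsOf.1 (hX.itemsOf_subset ha)
  exact mem_itemsOf.2 ⟨e, List.mem_of_mem_take he, hae⟩

lemma itemsOf_append (s t : Seqc I) : itemsOf (s ++ t) = itemsOf s ∪ itemsOf t := by
  ext a
  simp [mem_itemsOf, or_and_right, exists_or]

lemma itemsOf_singleton (e : Finset I) : itemsOf [e] = e := by
  simp [itemsOf]

lemma itemsOf_sExt (X : Seqc I) (i : I) : itemsOf (sExt X i) = insert i (itemsOf X) := by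
  rw [sExt, itemsOf_append, itemsOf_singleton, Finset.union_comm, Finset.insert_eq]

lemma itemsOf_iExt (X : Seqc I) (i : I) : itemsOf (iExt X i) = insert i (itemsOf X) := by
  rcases X.eq_nil_or_concat with rfl | ⟨L, e, rfl⟩
  · simp [iExt, itemsOf]
  · simp [iExt, itemsOf_append, itemsOf_singleton, List.getLastD_eq_getLast?]

lemma IsLeftExp.itemsOf_eq {X Y X' : Seqc I} {i : I} (h : IsLeftExp X Y i X') :
    itemsOf X' = insert i (itemsOf X) := by
  obtain ⟨-, ⟨rfl, -⟩ | rfl⟩ := h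
  · exact itemsOf_iExt X i
  · exact itemsOf_sExt X i

/-- The utility of a left expansion in a sequence where it occurs is at most the
`LEPEU` value there of the rule it expands. -/
lemma ruleUtilIn_le_LEPEUs {X Y X' s : Seqc I} {i : I}
    (hpos : ∀ j ∈ itemsOf s, 0 < itemUtil q iu j s)
    (hexp : IsLeftExp X Y i X') (hs : RuleOccursIn X' Y s) :
    ruleUtilIn q iu X' Y s ≤ LEPEUs q iu X Y s := by
  have hi : i ∈ itemsOf s :=
    hs.itemsOf_left_subset (hexp.itemsOf_eq ▸ Finset.mem_insert_self i _)
  have hle : itemUtil q iu i s ≤ ULeft q iu X Y s :=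
    Finset.single_le_sum (f := fun j => itemUtil q iu j s)
      (fun j hj => (hpos j (Finset.mem_filter.1 hj).1).le)
      (Finset.mem_filter.2 ⟨hi, X', hexp, hs⟩)
  rw [LEPEUs, if_pos ((hpos i hi).trans_le hle), ruleUtilIn, ruleUtilIn, hexp.itemsOf_eq,
    Finset.insert_union]
  by_cases h : i ∈ itemsOf X ∪ itemsOf Y
  · rw [Finset.insert_eq_of_mem h]
    linarith [hpos i hi]
  · rw [Finset.sum_insert h]
    linarith

/-- if r' is obtained from r = X → Y by a left I- or S-expansion
with item i, then u(r') ≤ LERSU(r') = Σ_{s ∈ seq(r')} LEPEU(r, s). -/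
theorem utility_le_LERSU_of_leftExp
    (hiu : ∀ j : I, 0 < iu j)
    (hq : ∀ (j : I) (s : Seqc I), j ∈ itemsOf s → 0 < q j s)
    (D : List (Seqc I)) (hD : ∀ s ∈ D, WFSeq s)
    (X Y : Seqc I) (hX : WFSeq X) (hY : WFSeq Y)
    (hXY : Disjoint (itemsOf X) (itemsOf Y))
    (i : I) (X' : Seqc I) (hexp : IsLeftExp X Y i X')
    (hX' : WFSeq X') (hX'Y : Disjoint (itemsOf X') (itemsOf Y)) :
    ruleUtil q iu D X' Y ≤ ((seqL D X' Y).map (LEPEUs q iu X Y)).sum := by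
  refine List.sum_le_sum fun s hs => ruleUtilIn_le_LEPEUs q iu
    (fun j hj => mul_pos (hq j s hj) (hiu j)) hexp ?_
  simpa using (List.mem_filter.1 hs).2

end TotalSR
end
end

section
/- Let r = X → Y be a totally-ordered sequential rule over a sequence database D, and let r' = X → Y⋄i be a ToSR obtained from r by a right I-expansion or a right S-expansion with an item i. Then ant(r') = ant(r) and seq(r') ⊆ seq(r), and consequently conf(r') ≤ conf(r); in particular, for any threshold minconf, if conf(r) < minconf then conf(r') < minconf. -/
open scoped Classical

noncomputable section

namespace TotalSR

variable {I : Type*} [LinearOrder I]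

variable (q : I → Seqc I → ℝ) (iu : I → ℝ)

theorem occursIn_iff_sublistForall₂ {s₁ s₂ : Seqc I} :
    OccursIn s₁ s₂ ↔ List.SublistForall₂ (· ⊆ ·) s₁ s₂ := by
  simp only [OccursIn, List.sublistForall₂_iff, and_comm]

theorem OccursIn.trans {s₁ s₂ s₃ : Seqc I} (h₁ : OccursIn s₁ s₂) (h₂ : OccursIn s₂ s₃) :
    OccursIn s₁ s₃ := by
  rw [occursIn_iff_sublistForall₂] at *
  exact _root_.trans h₁ h₂

theorem occursIn_sExt (s : Seqc I) (i : I) : OccursIn s (sExt s i) :=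
  ⟨s, List.sublist_append_left s _, List.forall₂_refl s⟩

theorem occursIn_iExt {s : Seqc I} (hs : s ≠ []) (i : I) : OccursIn s (iExt s i) := by
  refine ⟨iExt s i, List.Sublist.refl _, ?_⟩
  conv_lhs => rw [← List.dropLast_append_getLast hs]
  rw [iExt, List.getLastD_eq_getLast?, List.getLast?_eq_some_getLast hs, Option.getD_some]
  exact List.rel_append (List.forall₂_refl _)
    (List.Forall₂.cons (Finset.subset_insert _ _) List.Forall₂.nil)

theorem IsRightExp.occursIn {X Y Y' : Seqc I} {i : I} (h : IsRightExp X Y i Y') (hY : Y ≠ []) :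
    OccursIn Y Y' := by
  obtain ⟨-, ⟨rfl, -⟩ | rfl⟩ := h
  · exact occursIn_iExt hY i
  · exact occursIn_sExt Y i

theorem RuleOccursIn.of_occursIn_right {X Y Y' s : Seqc I} (h : RuleOccursIn X Y' s)
    (hY : OccursIn Y Y') : RuleOccursIn X Y s := by
  obtain ⟨k, hk, hks, hX, hY'⟩ := h
  exact ⟨k, hk, hks, hX, hY.trans hY'⟩

theorem seqL_sublist_of_occursIn_right (D : List (Seqc I)) (X : Seqc I) {Y Y' : Seqc I}
    (hY : OccursIn Y Y') : (seqL D X Y').Sublist (seqL D X Y) :=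
  List.monotone_filter_right D fun s hs => by
    simp only [decide_eq_true_eq] at hs ⊢
    exact hs.of_occursIn_right hY

theorem conf_le_of_occursIn_right (D : List (Seqc I)) (X : Seqc I) {Y Y' : Seqc I}
    (hY : OccursIn Y Y') : conf D X Y' ≤ conf D X Y := by
  unfold conf
  gcongr
  exact (seqL_sublist_of_occursIn_right D X hY).length_le

/-- for a right expansion r' = X → Y⋄i of r = X → Y, the antecedent
sequences coincide, seq(r') ⊆ seq(r), confidence is anti-monotonic, and in
particular if conf(r) < minconf then conf(r') < minconf. -/
theorem conf_antimonotone_of_rightExp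
    (hiu : ∀ j : I, 0 < iu j)
    (hq : ∀ (j : I) (s : Seqc I), j ∈ itemsOf s → 0 < q j s)
    (D : List (Seqc I)) (hD : ∀ s ∈ D, WFSeq s)
    (X Y : Seqc I) (hX : WFSeq X) (hY : WFSeq Y)
    (hXY : Disjoint (itemsOf X) (itemsOf Y))
    (i : I) (Y' : Seqc I) (hexp : IsRightExp X Y i Y')
    (hY' : WFSeq Y') (hXY' : Disjoint (itemsOf X) (itemsOf Y')) :
    antL D X = antL D X ∧
    (∀ s ∈ seqL D X Y', s ∈ seqL D X Y) ∧
    conf D X Y' ≤ conf D X Y ∧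
    ∀ minconf : ℝ, conf D X Y < minconf → conf D X Y' < minconf := by
  have hYY' : OccursIn Y Y' := hexp.occursIn hY.1
  have hconf := conf_le_of_occursIn_right D X hYY'
  exact ⟨rfl, (seqL_sublist_of_occursIn_right D X hYY').subset, hconf,
    fun _ h => hconf.trans_lt h⟩

end TotalSR
end
end
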